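/- Let d_n = (16^n/(n!)²)·c_{4,2n+1}, let A_n = Σ_{k=0}^n C(n,k)²·C(2k,k)·C(2n−2k,n−k), and let (B_n) be the sequence determined by B_0 = 0, B_1 = 1 and the recursion (n+2)³B_{n+2} = 2(2n+3)(5n²+15n+12)B_{n+1} − 64(n+1)³B_n. Then for every integer n ≥ 0, d_n = (7/8)·ζ(3)·A_n − 3·B_n. -/

import Mathlib

open MeasureTheory

/-- The modified Bessel function `K₀`, via `K₀(x) = ∫₀^∞ exp(−x cosh t) dt`. -/
noncomputable def besselK0 (x : ℝ) : ℝ :=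
  ∫ t in Set.Ioi (0 : ℝ), Real.exp (-x * Real.cosh t)

/-- The Bessel moment `c_{m,k} = ∫₀^∞ x^k K₀(x)^m dx`. -/
noncomputable def besselMoment (m k : ℕ) : ℝ :=
  ∫ x in Set.Ioi (0 : ℝ), x ^ k * besselK0 x ^ m

/-- `ζ(3) = Σ_{n≥1} 1/n³`. -/
noncomputable def zeta3 : ℝ := ∑' n : ℕ, 1 / ((n : ℝ) + 1) ^ 3

section Domb
open PowerSeries

/-- The power series `∑ tⁿ / (n!)²`, i.e. `I₀(2√t)`. -/
noncomputable def besselISeries : PowerSeries ℝ :=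
  PowerSeries.mk fun n => 1 / (n.factorial : ℝ) ^ 2

theorem X_mul_derivative_besselISeries :
    X * d⁄dX ℝ (X * d⁄dX ℝ besselISeries) = X * besselISeries := by
  ext n
  cases n with
  | zero => simp
  | succ n =>
    cases n with
    | zero =>
      simp only [coeff_succ_X_mul, coeff_derivative, besselISeries, coeff_mk]
      simp [-coeff_zero_eq_constantCoeff]
    | succ n =>
      simp only [coeff_succ_X_mul, coeff_derivative, besselISeries, coeff_mk, Nat.factorial_succ]
      have := Nat.factorial_ne_zero n
      push_cast
      field_simp

theorem coeff_X_mul_derivative (f : PowerSeries ℝ) (n : ℕ) :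
    coeff n (X * d⁄dX ℝ f) = n * coeff n f := by
  cases n with
  | zero => simp
  | succ n => simp [coeff_succ_X_mul, coeff_derivative, mul_comm]

theorem coeff_besselISeries_sq (n : ℕ) :
    coeff n (besselISeries ^ 2) = ((2 * n).choose n : ℝ) / (n.factorial : ℝ) ^ 2 := by
  rw [pow_two, coeff_mul, Finset.Nat.sum_antidiagonal_eq_sum_range_succ_mk,
    ← Nat.sum_range_choose_sq, Nat.cast_sum, Finset.sum_div]
  refine Finset.sum_congr rfl fun k hk => ?_
  have hk : k ≤ n := by simpa [Nat.lt_succ_iff] using hk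
  have h1 := Nat.factorial_ne_zero n
  have h2 := Nat.factorial_ne_zero k
  have h3 := Nat.factorial_ne_zero (n - k)
  simp only [besselISeries, coeff_mk]
  rw [Nat.cast_pow, Nat.cast_choose ℝ hk]
  field_simp

theorem coeff_besselISeries_pow_four (n : ℕ) :
    coeff n (besselISeries ^ 4) = (∑ k ∈ Finset.range (n + 1),
      ((n.choose k : ℝ)) ^ 2 * ((2 * k).choose k : ℝ) * ((2 * n - 2 * k).choose (n - k) : ℝ))
        / (n.factorial : ℝ) ^ 2 := by
  rw [show besselISeries ^ 4 = besselISeries ^ 2 * besselISeries ^ 2 by ring, coeff_mul,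
    Finset.Nat.sum_antidiagonal_eq_sum_range_succ_mk, Finset.sum_div]
  refine Finset.sum_congr rfl fun k hk => ?_
  have hk : k ≤ n := by simpa [Nat.lt_succ_iff] using hk
  have h1 := Nat.factorial_ne_zero n
  have h2 := Nat.factorial_ne_zero k
  have h3 := Nat.factorial_ne_zero (n - k)
  simp only [coeff_besselISeries_sq]
  rw [Nat.cast_choose ℝ hk, ← Nat.mul_sub]
  field_simp

/-- The recursion for the coefficients of `I₀⁴`, obtained by eliminating the coefficients of
`I₀ᵃ (θ I₀)ᵇ`, `a + b = 4`, from the relations given by `θ² I₀ = t I₀`. -/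
theorem coeff_besselISeries_pow_four_rec (n : ℕ) :
    ((n : ℝ) + 2) ^ 5 * coeff (n + 2) (besselISeries ^ 4)
      = 2 * (2 * (n : ℝ) + 3) * (5 * (n : ℝ) ^ 2 + 15 * n + 12)
          * coeff (n + 1) (besselISeries ^ 4)
        - 64 * ((n : ℝ) + 1) * coeff n (besselISeries ^ 4) := by
  set f := besselISeries with hf
  set g := X * d⁄dX ℝ f with hg
  have hdg : X * d⁄dX ℝ g = X * f := X_mul_derivative_besselISeries
  have e0 : X * d⁄dX ℝ (f ^ 4) = 4 * (f ^ 3 * g) := by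
    simp only [Derivation.leibniz_pow, smul_eq_mul, nsmul_eq_mul]
    push_cast
    ring
  have e1 : X * d⁄dX ℝ (f ^ 3 * g) = 3 * (f ^ 2 * g ^ 2) + X * f ^ 4 := by
    simp only [Derivation.leibniz, Derivation.leibniz_pow, smul_eq_mul, nsmul_eq_mul]
    push_cast
    linear_combination f ^ 3 * hdg
  have e2 : X * d⁄dX ℝ (f ^ 2 * g ^ 2) = 2 * (f * g ^ 3) + 2 * (X * (f ^ 3 * g)) := by
    simp only [Derivation.leibniz, Derivation.leibniz_pow, smul_eq_mul, nsmul_eq_mul]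
    push_cast
    linear_combination 2 * f ^ 2 * g * hdg
  have e3 : X * d⁄dX ℝ (f * g ^ 3) = g ^ 4 + 3 * (X * (f ^ 2 * g ^ 2)) := by
    simp only [Derivation.leibniz, Derivation.leibniz_pow, smul_eq_mul, nsmul_eq_mul]
    push_cast
    linear_combination 3 * f * g ^ 2 * hdg
  have e4 : X * d⁄dX ℝ (g ^ 4) = 4 * (X * (f * g ^ 3)) := by
    simp only [Derivation.leibniz_pow, smul_eq_mul, nsmul_eq_mul]
    push_cast
    linear_combination 4 * g ^ 3 * hdg
  have hc : ∀ (m : ℕ) (p : PowerSeries ℝ) (c : ℕ),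
      coeff m ((c : PowerSeries ℝ) * p) = c * coeff m p := fun m p c => by
    rw [← nsmul_eq_mul, map_nsmul, nsmul_eq_mul]
  have key : ∀ {u v : PowerSeries ℝ}, X * d⁄dX ℝ u = v → ∀ m : ℕ, m * coeff m u = coeff m v :=
    fun h m => by rw [← h, coeff_X_mul_derivative]
  have hc2 := fun m p => hc m p 2
  have hc3 := fun m p => hc m p 3
  have hc4 := fun m p => hc m p 4
  push_cast at hc2 hc3 hc4
  have k0 := key e0
  have k1 := key e1
  have k2 := key e2
  have k3 := key e3
  have k4 := key e4
  simp only [map_add, hc2, hc3, hc4] at k0 k1 k2 k3 k4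
  have a0 := k0 n
  have a1 := k0 (n + 1)
  have a2 := k0 (n + 2)
  have b1 := k1 (n + 1)
  have b2 := k1 (n + 2)
  have c1 := k2 (n + 1)
  have c2 := k2 (n + 2)
  have d2 := k3 (n + 2)
  have f2 := k4 (n + 2)
  simp only [coeff_succ_X_mul] at a0 a1 a2 b1 b2 c1 c2 d2 f2
  push_cast at a0 a1 a2 b1 b2 c1 c2 d2 f2
  linear_combination ((n : ℝ) + 2) ^ 4 * a2 + 4 * ((n : ℝ) + 2) ^ 3 * b2
    + 12 * ((n : ℝ) + 2) ^ 2 * c2 + 24 * ((n : ℝ) + 2) * d2 + 24 * f2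
    - 48 * c1 - (40 * (n : ℝ) + 64) * b1
    - (24 * ((n : ℝ) + 2) ^ 2 + (40 * (n : ℝ) + 64) * ((n : ℝ) + 1)) / 4 * a1 + 24 * a0

end Domb

section CoshMoments
open Set Filter Topology Real

/-- `∫₀^∞ cosh(t)ʲ exp(-x cosh t) dt`, i.e. `(-1)ʲ` times the `j`-th derivative of `K₀`. -/
noncomputable def coshMoment (j : ℕ) (x : ℝ) : ℝ :=
  ∫ t in Ioi (0 : ℝ), cosh t ^ j * exp (-x * cosh t)

theorem besselK0_eq_coshMoment : besselK0 = coshMoment 0 := by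
  ext x
  simp [besselK0, coshMoment]

theorem le_cosh_self (t : ℝ) : t ≤ cosh t := by
  rcases le_total 0 t with h | h
  · exact (self_le_sinh_iff.2 h).trans (sinh_lt_cosh t).le
  · exact h.trans (cosh_pos t).le

theorem integrableOn_cosh_pow_mul_exp (j : ℕ) {x : ℝ} (hx : 0 < x) :
    IntegrableOn (fun t => cosh t ^ j * exp (-x * cosh t)) (Ioi 0) := by
  have hb : IntegrableOn (fun t => (2 / x) ^ j * j.factorial * exp (-(x / 2) * t)) (Ioi 0) :=
    (exp_neg_integrableOn_Ioi 0 (half_pos hx)).const_mul _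
  refine Integrable.mono' hb (by fun_prop) (ae_of_all _ fun t => ?_)
  have hc := cosh_pos t
  rw [norm_of_nonneg (by positivity)]
  have h1 : cosh t ^ j ≤ (2 / x) ^ j * j.factorial * exp (x / 2 * cosh t) := by
    have := pow_div_factorial_le_exp (x / 2 * cosh t) (by positivity) j
    rw [div_le_iff₀ (by positivity)] at this
    calc cosh t ^ j = (2 / x) ^ j * (x / 2 * cosh t) ^ j := by
          rw [← mul_pow]; congr 1; field_simp
      _ ≤ (2 / x) ^ j * (exp (x / 2 * cosh t) * j.factorial) := by gcongr
      _ = _ := by ring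
  calc cosh t ^ j * exp (-x * cosh t)
      ≤ (2 / x) ^ j * j.factorial * exp (x / 2 * cosh t) * exp (-x * cosh t) := by gcongr
    _ = (2 / x) ^ j * j.factorial * exp (-(x / 2) * cosh t) := by
        rw [mul_assoc, ← exp_add]; congr 2; ring
    _ ≤ (2 / x) ^ j * j.factorial * exp (-(x / 2) * t) := by
        have := le_cosh_self t
        gcongr ?_ * exp ?_
        nlinarith

theorem hasDerivAt_coshMoment (j : ℕ) {x : ℝ} (hx : 0 < x) :
    HasDerivAt (coshMoment j) (-coshMoment (j + 1) x) x := by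
  have := (hasDerivAt_integral_of_dominated_loc_of_deriv_le (μ := volume.restrict (Ioi (0 : ℝ)))
    (F := fun x t => cosh t ^ j * exp (-x * cosh t))
    (F' := fun x t => -(cosh t ^ (j + 1) * exp (-x * cosh t))) (x₀ := x) (s := Ioi (x / 2))
    (bound := fun t => cosh t ^ (j + 1) * exp (-(x / 2) * cosh t))
    (Ioi_mem_nhds (half_lt_self hx)) (Eventually.of_forall fun y => by fun_prop)
    (integrableOn_cosh_pow_mul_exp j hx) (by fun_prop) (ae_of_all _ fun t y hy => ?_)
    (integrableOn_cosh_pow_mul_exp (j + 1) (half_pos hx)) (ae_of_all _ fun t y _ => ?_)).2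
  · rw [integral_neg] at this
    exact this
  · have hc := cosh_pos t
    have hy : x / 2 < y := hy
    rw [norm_neg, norm_of_nonneg (by positivity)]
    gcongr
  · have := (((hasDerivAt_id y).neg.mul_const (cosh t)).exp).const_mul (cosh t ^ j)
    convert! this using 1
    simp
    ring

theorem tendsto_cosh_atTop : Tendsto cosh atTop atTop :=
  tendsto_atTop_mono le_cosh_self tendsto_id

theorem tendsto_cosh_pow_mul_exp (j : ℕ) {x : ℝ} (hx : 0 < x) :
    Tendsto (fun t => cosh t ^ j * exp (-x * cosh t)) atTop (𝓝 0) := by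
  have h := (tendsto_pow_mul_exp_neg_atTop_nhds_zero j).comp
    (tendsto_cosh_atTop.const_mul_atTop hx)
  have h2 := h.const_mul ((1 / x) ^ j)
  rw [mul_zero] at h2
  refine h2.congr fun t => ?_
  simp only [Function.comp]
  rw [mul_pow, ← mul_assoc, ← mul_assoc, ← mul_pow, one_div_mul_cancel hx.ne', one_pow, one_mul,
    neg_mul]

theorem integrableOn_sinh_mul_exp {x : ℝ} (hx : 0 < x) :
    IntegrableOn (fun t => sinh t * exp (-x * cosh t)) (Ioi 0) := by
  refine Integrable.mono' (integrableOn_cosh_pow_mul_exp 1 hx) (by fun_prop)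
    (ae_of_all _ fun t => ?_)
  rw [norm_mul, norm_of_nonneg (exp_pos _).le, pow_one]
  gcongr
  rw [norm_eq_abs, abs_le]
  have h1 := cosh_add_sinh t
  have h2 := cosh_sub_sinh t
  have h3 := exp_pos t
  have h4 := exp_pos (-t)
  constructor <;> linarith

theorem integral_sinh_mul_exp {x : ℝ} (hx : 0 < x) :
    x * ∫ t in Ioi (0 : ℝ), sinh t * exp (-x * cosh t) = exp (-x) := by
  rw [← integral_const_mul]
  have := integral_Ioi_of_hasDerivAt_of_tendsto' (f := fun t => -exp (-x * cosh t))
    (f' := fun t => x * (sinh t * exp (-x * cosh t))) (a := 0) (m := 0) (fun t _ => ?_)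
    ((integrableOn_sinh_mul_exp hx).const_mul x) ?_
  · rw [this]; simp
  · have := (((hasDerivAt_cosh t).const_mul (-x)).exp).neg
    convert! this using 1
    ring
  · simpa using (tendsto_cosh_pow_mul_exp 0 hx).neg

theorem exp_neg_le_mul_coshMoment_one {x : ℝ} (hx : 0 < x) :
    exp (-x) ≤ x * coshMoment 1 x := by
  rw [← integral_sinh_mul_exp hx, coshMoment]
  gcongr x * ?_
  refine integral_mono (integrableOn_sinh_mul_exp hx) (integrableOn_cosh_pow_mul_exp 1 hx)
    fun t => ?_
  have := (sinh_lt_cosh t).le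
  simp only [pow_one]
  gcongr

theorem mul_coshMoment_one_le {x : ℝ} (hx : 0 < x) :
    x * coshMoment 1 x ≤ exp (-x) + x * coshMoment 0 x := by
  rw [← integral_sinh_mul_exp hx, coshMoment, coshMoment, ← mul_add,
    ← integral_add (integrableOn_sinh_mul_exp hx) (integrableOn_cosh_pow_mul_exp 0 hx)]
  gcongr x * ?_
  refine setIntegral_mono_on (integrableOn_cosh_pow_mul_exp 1 hx)
    ((integrableOn_sinh_mul_exp hx).add (integrableOn_cosh_pow_mul_exp 0 hx)) measurableSet_Ioi
    fun t ht => ?_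
  have h2 := cosh_sub_sinh t
  have h4 : exp (-t) ≤ 1 := exp_le_one_iff.2 (neg_nonpos.2 (le_of_lt ht))
  simp only [pow_one, pow_zero, ← add_mul]
  gcongr
  linarith

theorem mul_coshMoment_two_sub {x : ℝ} (hx : 0 < x) :
    x * coshMoment 2 x - x * coshMoment 0 x = coshMoment 1 x := by
  have hi := ((integrableOn_cosh_pow_mul_exp 1 hx).sub
    ((integrableOn_cosh_pow_mul_exp 2 hx).const_mul x)).add
    ((integrableOn_cosh_pow_mul_exp 0 hx).const_mul x)
  have := integral_Ioi_of_hasDerivAt_of_tendsto' (f := fun t => sinh t * exp (-x * cosh t))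
    (a := 0) (m := 0) (fun t _ => ?_) hi ?_
  · simp only [Pi.add_apply, Pi.sub_apply] at this
    rw [integral_add, integral_sub, integral_const_mul, integral_const_mul] at this
    · simp only [sinh_zero, zero_mul, sub_zero] at this
      simp only [coshMoment]
      linarith
    · exact integrableOn_cosh_pow_mul_exp 1 hx
    · exact (integrableOn_cosh_pow_mul_exp 2 hx).const_mul x
    · exact (integrableOn_cosh_pow_mul_exp 1 hx).sub
        ((integrableOn_cosh_pow_mul_exp 2 hx).const_mul x)
    · exact (integrableOn_cosh_pow_mul_exp 0 hx).const_mul x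
  · have := (hasDerivAt_sinh t).mul (((hasDerivAt_cosh t).const_mul (-x)).exp)
    convert! this using 1
    simp only [Pi.add_apply, Pi.sub_apply]
    linear_combination -x * exp (-x * cosh t) * cosh_sq_sub_sinh_sq t
  · refine squeeze_zero' (g := fun t => cosh t ^ 1 * exp (-x * cosh t)) ?_ ?_
      (tendsto_cosh_pow_mul_exp 1 hx)
    · filter_upwards [eventually_ge_atTop 0] with t ht
      have := sinh_nonneg_iff.2 ht
      positivity
    · refine Eventually.of_forall fun t => ?_
      have := (sinh_lt_cosh t).le
      simp only [pow_one]
      gcongr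

/-- `θ K₀ = x dK₀/dx = -x K₁(x)`. -/
noncomputable def besselThetaK0 (x : ℝ) : ℝ := -(x * coshMoment 1 x)

theorem hasDerivAt_besselK0 {x : ℝ} (hx : 0 < x) :
    HasDerivAt besselK0 (besselThetaK0 x / x) x := by
  rw [besselK0_eq_coshMoment]
  convert! hasDerivAt_coshMoment 0 hx using 1
  rw [besselThetaK0]
  field_simp

theorem hasDerivAt_besselThetaK0 {x : ℝ} (hx : 0 < x) :
    HasDerivAt besselThetaK0 (x * besselK0 x) x := by
  have h : HasDerivAt (coshMoment 1) (-coshMoment 2 x) x := hasDerivAt_coshMoment 1 hx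
  have := ((hasDerivAt_id x).mul h).neg
  rw [besselK0_eq_coshMoment]
  convert! this using 1
  simp only [id]
  linear_combination -mul_coshMoment_two_sub hx

theorem coshMoment_nonneg (j : ℕ) (x : ℝ) : 0 ≤ coshMoment j x :=
  integral_nonneg fun t => by have := cosh_pos t; positivity

theorem mul_coshMoment_zero_pow_four_le {y : ℝ} (hy : 0 < y) :
    y * coshMoment 0 (y ^ 4) ≤ 8 * exp (-(y ^ 4 / 2)) := by
  have hint := (exp_neg_integrableOn_Ioi 0 (by norm_num : (0 : ℝ) < 1 / 4)).const_mul
    (2 / y * exp (-(y ^ 4 / 2)))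
  have h : coshMoment 0 (y ^ 4) ≤
      ∫ t in Ioi (0 : ℝ), 2 / y * exp (-(y ^ 4 / 2)) * exp (-(1 / 4) * t) := by
    refine integral_mono (integrableOn_cosh_pow_mul_exp 0 (by positivity)) hint fun t => ?_
    simp only [pow_zero, one_mul]
    set z := y * exp (t / 4) with hz
    have hz0 : 0 < z := by positivity
    have h1 : exp (-(z ^ 4 / 4)) ≤ 2 / z := by
      rw [exp_neg, inv_le_comm₀ (exp_pos _) (by positivity)]
      have := add_one_le_exp (z ^ 4 / 4)
      rw [inv_div]
      nlinarith [sq_nonneg (z ^ 2 - 1), sq_nonneg (z - 1)]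
    have hz4 : z ^ 4 = y ^ 4 * exp t := by
      rw [hz, mul_pow, ← exp_nat_mul]; congr 2; push_cast; ring
    have hcosh : exp t ≤ 2 * cosh t := by
      rw [cosh_eq]; linarith [exp_pos (-t)]
    have h1c := one_le_cosh t
    have hy4 : 0 < y ^ 4 := by positivity
    calc exp (-y ^ 4 * cosh t) ≤ exp (-(y ^ 4 / 2) + -(z ^ 4 / 4)) := by
          rw [exp_le_exp, hz4]
          nlinarith
      _ = exp (-(y ^ 4 / 2)) * exp (-(z ^ 4 / 4)) := exp_add _ _
      _ ≤ exp (-(y ^ 4 / 2)) * (2 / z) := by gcongr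
      _ = 2 / y * exp (-(y ^ 4 / 2)) * exp (-(1 / 4) * t) := by
          rw [hz, show -(1 / 4) * t = -(t / 4) by ring, exp_neg (t / 4)]
          field_simp
  rw [integral_const_mul, integral_exp_mul_Ioi (by norm_num)] at h
  calc y * coshMoment 0 (y ^ 4)
      ≤ y * (2 / y * exp (-(y ^ 4 / 2)) * (-exp (-(1 / 4) * 0) / -(1 / 4))) := by gcongr
    _ = _ := by rw [mul_zero, exp_zero]; field_simp; norm_num

/-- Both `K₀` and `θ K₀` are `O(x^(-1/4) e^(-x/4))` on the half-line. -/
theorem exists_besselK0_bound {x : ℝ} (hx : 0 < x) :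
    ∃ r : ℝ, 0 < r ∧ r ^ 4 = x ∧ |besselK0 x| ≤ 37 * exp (-(x / 4)) / r ∧
      |besselThetaK0 x| ≤ 37 * exp (-(x / 4)) / r := by
  obtain ⟨r, hr, hrx⟩ : ∃ r : ℝ, 0 < r ∧ r ^ 4 = x :=
    ⟨x ^ (1 / 4 : ℝ), by positivity, by rw [← rpow_natCast, ← rpow_mul hx.le]; norm_num⟩
  refine ⟨r, hr, hrx, ?_⟩
  have hK := mul_coshMoment_zero_pow_four_le hr
  rw [hrx] at hK
  have hK0 := coshMoment_nonneg 0 x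
  have hL0 := coshMoment_nonneg 1 x
  have hE : exp (-(x / 2)) = exp (-(x / 4)) ^ 2 := by
    rw [← exp_nat_mul]; congr 1; push_cast; ring
  have hE4 : exp (-x) = exp (-(x / 4)) ^ 4 := by
    rw [← exp_nat_mul]; congr 1; push_cast; ring
  have hL := mul_coshMoment_one_le hx
  rw [hE] at hK
  rw [hE4] at hL
  have hxe : (1 + x / 4) * exp (-(x / 4)) ≤ 1 := by
    have h := add_one_le_exp (x / 4)
    have h' : exp (x / 4) * exp (-(x / 4)) = 1 := by rw [← exp_add]; simp
    nlinarith [exp_pos (-(x / 4))]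
  set E := exp (-(x / 4))
  have hEp : 0 < E := exp_pos _
  have hE1 : E ≤ 1 := by nlinarith
  have hxE : x * E ≤ 4 := by nlinarith
  have hrE : r * E ≤ 5 := by
    have : r ≤ 1 + x := by rw [← hrx]; nlinarith [sq_nonneg (r ^ 2 - 1), sq_nonneg (r - 1)]
    nlinarith
  constructor
  · rw [besselK0_eq_coshMoment, abs_of_nonneg hK0, le_div_iff₀ hr]
    nlinarith
  · rw [besselThetaK0, abs_neg, abs_of_nonneg (by positivity), le_div_iff₀ hr]
    have h1 : r * E ^ 4 ≤ 5 * E := by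
      have : E ^ 3 ≤ 1 := pow_le_one₀ hEp.le hE1
      have h2 : r * E ^ 4 = (r * E) * (E ^ 3) := by ring
      have h3 : E ^ 3 ≤ E := by nlinarith [mul_pos hEp hEp]
      rw [h2]
      gcongr
    have h2 : x * (r * coshMoment 0 x) ≤ 32 * E := by
      nlinarith [mul_le_mul_of_nonneg_left hK hx.le, mul_le_mul_of_nonneg_left hxE hEp.le]
    nlinarith

theorem abs_besselK0_pow_mul_besselThetaK0_pow_le {a b : ℕ} (hab : a + b = 4) {x : ℝ}
    (hx : 0 < x) : |besselK0 x ^ a * besselThetaK0 x ^ b| ≤ 37 ^ 4 * exp (-x) / x := by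
  obtain ⟨r, hr, hrx, hK, hL⟩ := exists_besselK0_bound hx
  rw [abs_mul, abs_pow, abs_pow]
  calc |besselK0 x| ^ a * |besselThetaK0 x| ^ b
      ≤ (37 * exp (-(x / 4)) / r) ^ a * (37 * exp (-(x / 4)) / r) ^ b := by gcongr
    _ = 37 ^ 4 * exp (-(x / 4)) ^ 4 / r ^ 4 := by rw [← pow_add, hab]; ring
    _ = _ := by rw [hrx, ← exp_nat_mul]; congr 3; push_cast; ring

end CoshMoments

section MomentRecursion
open Set Filter Topology Real

theorem continuousOn_besselK0 : ContinuousOn besselK0 (Ioi 0) := fun _ hx =>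
  (hasDerivAt_besselK0 hx).continuousAt.continuousWithinAt

theorem continuousOn_besselThetaK0 : ContinuousOn besselThetaK0 (Ioi 0) := fun _ hx =>
  (hasDerivAt_besselThetaK0 hx).continuousAt.continuousWithinAt

theorem integrableOn_pow_mul_exp_neg (k : ℕ) :
    IntegrableOn (fun x : ℝ => x ^ k * exp (-x)) (Ioi 0) := by
  refine (GammaIntegral_convergent (s := k + 1) (by positivity)).congr_fun (fun x _ => ?_)
    measurableSet_Ioi
  simp [mul_comm]

/-- The mixed moment `∫₀^∞ xᵏ K₀ᵃ (θ K₀)ᵇ dx`. -/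
noncomputable def mixedMoment (a b k : ℕ) : ℝ :=
  ∫ x in Ioi (0 : ℝ), x ^ k * (besselK0 x ^ a * besselThetaK0 x ^ b)

theorem pow_succ_mul_abs_le {a b : ℕ} (hab : a + b = 4) (k : ℕ) {x : ℝ} (hx : 0 < x) :
    |x ^ (k + 1) * (besselK0 x ^ a * besselThetaK0 x ^ b)| ≤ 37 ^ 4 * (x ^ k * exp (-x)) := by
  rw [abs_mul, abs_of_nonneg (by positivity)]
  calc x ^ (k + 1) * |besselK0 x ^ a * besselThetaK0 x ^ b|
      ≤ x ^ (k + 1) * (37 ^ 4 * exp (-x) / x) := by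
        gcongr
        exact abs_besselK0_pow_mul_besselThetaK0_pow_le hab hx
    _ = 37 ^ 4 * (x ^ k * exp (-x)) := by rw [pow_succ]; field_simp

theorem integrableOn_mixed {a b : ℕ} (hab : a + b = 4) (k : ℕ) :
    IntegrableOn (fun x => x ^ (k + 1) * (besselK0 x ^ a * besselThetaK0 x ^ b)) (Ioi 0) := by
  refine Integrable.mono' ((integrableOn_pow_mul_exp_neg k).const_mul (37 ^ 4)) ?_ ?_
  · refine ContinuousOn.aestronglyMeasurable ?_ measurableSet_Ioi
    exact (continuousOn_pow _).mul
      ((continuousOn_besselK0.pow a).mul (continuousOn_besselThetaK0.pow b))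
  · filter_upwards [ae_restrict_mem measurableSet_Ioi] with x hx
    exact pow_succ_mul_abs_le hab k hx

/-- Integration by parts for `x ^ (k + 2) * P`, where `P = K₀ᵃ (θ K₀)ᵇ`. -/
theorem integral_pow_mul_theta_mixed {a b : ℕ} (hab : a + b = 4) (k : ℕ) {Q : ℝ → ℝ}
    (hQ : ∀ x, 0 < x → HasDerivAt (fun x => besselK0 x ^ a * besselThetaK0 x ^ b) (Q x / x) x)
    (hQi : IntegrableOn (fun x => x ^ (k + 1) * Q x) (Ioi 0)) :
    ∫ x in Ioi (0 : ℝ), x ^ (k + 1) * Q x = -((k + 2) * mixedMoment a b (k + 1)) := by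
  set P := fun x => besselK0 x ^ a * besselThetaK0 x ^ b with hP
  have hPi : IntegrableOn (fun x => ((k : ℝ) + 2) * (x ^ (k + 1) * P x)) (Ioi 0) :=
    (integrableOn_mixed hab k).const_mul _
  have key := integral_Ioi_of_hasDerivAt_of_tendsto (f := fun x => x ^ (k + 2) * P x)
    (f' := fun x => ((k : ℝ) + 2) * (x ^ (k + 1) * P x) + x ^ (k + 1) * Q x) (a := 0) (m := 0)
    ?_ (fun x hx => ?_) (hPi.add hQi) ?_
  · rw [integral_add hPi hQi, integral_const_mul] at key
    simp only [ne_eq, Nat.add_eq_zero_iff, OfNat.ofNat_ne_zero, and_false, not_false_eq_true,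
      zero_pow, zero_mul, sub_zero] at key
    rw [mixedMoment]
    linarith
  · rw [← continuousWithinAt_Ioi_iff_Ici, ContinuousWithinAt]
    simp only [ne_eq, Nat.add_eq_zero_iff, OfNat.ofNat_ne_zero, and_false, not_false_eq_true,
      zero_pow, zero_mul]
    have h0 : Tendsto (fun x : ℝ => 37 ^ 4 * (x ^ (k + 1) * exp (-x))) (𝓝[>] 0) (𝓝 0) := by
      have : Continuous fun x : ℝ => 37 ^ 4 * (x ^ (k + 1) * exp (-x)) := by fun_prop
      simpa using (this.tendsto 0).mono_left nhdsWithin_le_nhds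
    refine squeeze_zero_norm' ?_ h0
    filter_upwards [self_mem_nhdsWithin] with x hx
    exact pow_succ_mul_abs_le hab (k + 1) hx
  · have hx : 0 < x := hx
    convert! (hasDerivAt_pow (k + 2) x).mul (hQ x hx) using 1
    push_cast
    field_simp
    ring
  · have h0 := (tendsto_pow_mul_exp_neg_atTop_nhds_zero (k + 1)).const_mul (37 ^ 4)
    rw [mul_zero] at h0
    refine squeeze_zero_norm' ?_ h0
    filter_upwards [eventually_gt_atTop 0] with x hx
    exact pow_succ_mul_abs_le hab (k + 1) hx

theorem tendsto_besselThetaK0_zero : Tendsto besselThetaK0 (𝓝[>] 0) (𝓝 (-1)) := by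
  have hle : ∀ x : ℝ, 0 < x → x * coshMoment 0 x ≤ 37 * x ^ (3 / 4 : ℝ) := fun x hx => by
    obtain ⟨r, hr, hrx, hK, -⟩ := exists_besselK0_bound hx
    rw [besselK0_eq_coshMoment] at hK
    have h3 : x ^ (3 / 4 : ℝ) = r ^ 3 := by
      rw [← hrx, ← rpow_natCast, ← rpow_natCast, ← rpow_mul hr.le]; norm_num
    have hE : exp (-(x / 4)) ≤ 1 := exp_le_one_iff.2 (by linarith)
    have : coshMoment 0 x ≤ 37 / r := (le_abs_self _).trans (hK.trans (by gcongr; linarith))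
    calc x * coshMoment 0 x ≤ x * (37 / r) := by gcongr
      _ = 37 * x ^ (3 / 4 : ℝ) := by rw [h3, ← hrx]; field_simp
  have h1 : Tendsto (fun x : ℝ => -exp (-x)) (𝓝[>] 0) (𝓝 (-1)) := by
    have : Continuous fun x : ℝ => -exp (-x) := by fun_prop
    simpa using (this.tendsto 0).mono_left nhdsWithin_le_nhds
  have h2 : Tendsto (fun x : ℝ => -exp (-x) - 37 * x ^ (3 / 4 : ℝ)) (𝓝[>] 0) (𝓝 (-1)) := by
    have : Continuous fun x : ℝ => -exp (-x) - 37 * x ^ (3 / 4 : ℝ) := by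
      have := continuous_rpow_const (q := 3 / 4) (by norm_num)
      fun_prop
    have h := (this.tendsto 0).mono_left (nhdsWithin_le_nhds (s := Ioi 0))
    simpa using h
  refine tendsto_of_tendsto_of_tendsto_of_le_of_le' h2 h1 ?_ ?_
  · filter_upwards [self_mem_nhdsWithin] with x hx
    have a := mul_coshMoment_one_le hx
    have b := hle x hx
    rw [besselThetaK0]
    linarith
  · filter_upwards [self_mem_nhdsWithin] with x hx
    have a := exp_neg_le_mul_coshMoment_one hx
    rw [besselThetaK0]
    linarith

theorem tendsto_besselThetaK0_atTop : Tendsto besselThetaK0 atTop (𝓝 0) := by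
  have h0 : Tendsto (fun x : ℝ => 37 * exp (-(x / 4))) atTop (𝓝 0) := by
    have := (tendsto_exp_neg_atTop_nhds_zero.comp
      (tendsto_id.atTop_div_const (by norm_num : (0 : ℝ) < 4))).const_mul 37
    simpa using this
  refine squeeze_zero_norm' ?_ h0
  filter_upwards [eventually_ge_atTop 1] with x hx
  obtain ⟨r, hr, hrx, -, hL⟩ := exists_besselK0_bound (by linarith : 0 < x)
  refine hL.trans (div_le_self (by positivity) ?_)
  by_contra! h
  have := pow_lt_one₀ hr.le h (by norm_num : (4 : ℕ) ≠ 0)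
  linarith

theorem hasDerivAt_besselThetaK0_pow_four {x : ℝ} (hx : 0 < x) :
    HasDerivAt (fun x => besselThetaK0 x ^ 4)
      (4 * (x ^ 1 * (besselK0 x ^ 1 * besselThetaK0 x ^ 3))) x := by
  convert! (hasDerivAt_besselThetaK0 hx).pow 4 using 1
  push_cast
  ring

theorem mixedMoment_one_three_one : mixedMoment 1 3 1 = -1 / 4 := by
  have hi : IntegrableOn (fun x => 4 * (x ^ 1 * (besselK0 x ^ 1 * besselThetaK0 x ^ 3)))
    (Ioi 0) := (integrableOn_mixed (a := 1) (b := 3) rfl 0).const_mul 4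
  have hb : Tendsto (fun x => besselThetaK0 x ^ 4) (𝓝[>] 0) (𝓝 1) := by
    convert! tendsto_besselThetaK0_zero.pow 4 using 2
    norm_num
  have key := integral_Ioi_of_hasDerivAt_of_tendsto
    (f := Function.update (fun x => besselThetaK0 x ^ 4) 0 1)
    (f' := fun x => 4 * (x ^ 1 * (besselK0 x ^ 1 * besselThetaK0 x ^ 3))) (a := 0) (m := 0)
    ?_ (fun x hx => ?_) hi ?_
  · rw [integral_const_mul, Function.update_self] at key
    rw [mixedMoment]
    linarith
  · rw [← continuousWithinAt_Ioi_iff_Ici, continuousWithinAt_update_same]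
    simpa using hb
  · refine (hasDerivAt_besselThetaK0_pow_four hx).congr_of_eventuallyEq ?_
    filter_upwards [Ioi_mem_nhds hx] with y hy
    rw [Function.update_of_ne (ne_of_gt hy)]
  · have := tendsto_besselThetaK0_atTop.pow 4
    rw [zero_pow (by norm_num)] at this
    refine this.congr' ?_
    filter_upwards [eventually_gt_atTop 0] with y hy
    rw [Function.update_of_ne (ne_of_gt hy)]

theorem mixedMoment_rec_zero (k : ℕ) :
    4 * mixedMoment 3 1 (k + 1) = -((k + 2) * mixedMoment 4 0 (k + 1)) := by
  have i1 := (integrableOn_mixed (a := 3) (b := 1) rfl k).const_mul 4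
  have hQ : ∀ x, 0 < x → HasDerivAt (fun x => besselK0 x ^ 4 * besselThetaK0 x ^ 0)
      (4 * (besselK0 x ^ 3 * besselThetaK0 x ^ 1) / x) x := fun x hx => by
    convert! ((hasDerivAt_besselK0 hx).pow 4).mul ((hasDerivAt_besselThetaK0 hx).pow 0) using 1
    simp
    ring
  rw [← integral_pow_mul_theta_mixed rfl k hQ, mixedMoment, ← integral_const_mul]
  · congr 1; ext x; ring
  · exact IntegrableOn.congr_fun i1 (fun x _ => by ring) measurableSet_Ioi

theorem mixedMoment_rec_succ {a b : ℕ} (hab : a + 1 + (b + 1) = 4) (k : ℕ) :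
    (a + 1) * mixedMoment a (b + 2) (k + 1) + (b + 1) * mixedMoment (a + 2) b (k + 3)
      = -((k + 2) * mixedMoment (a + 1) (b + 1) (k + 1)) := by
  have i1 := (integrableOn_mixed (a := a) (b := b + 2) (by omega) k).const_mul (a + 1)
  have i2 := (integrableOn_mixed (a := a + 2) (b := b) (by omega) (k + 2)).const_mul (b + 1)
  have hcongr : ∀ x : ℝ, (a + 1) * (x ^ (k + 1) * (besselK0 x ^ a * besselThetaK0 x ^ (b + 2)))
      + (b + 1) * (x ^ (k + 2 + 1) * (besselK0 x ^ (a + 2) * besselThetaK0 x ^ b))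
      = x ^ (k + 1) * ((a + 1) * (besselK0 x ^ a * besselThetaK0 x ^ (b + 2))
        + (b + 1) * (x ^ 2 * (besselK0 x ^ (a + 2) * besselThetaK0 x ^ b))) := fun x => by ring
  have hQ : ∀ x, 0 < x → HasDerivAt (fun x => besselK0 x ^ (a + 1) * besselThetaK0 x ^ (b + 1))
      (((a + 1) * (besselK0 x ^ a * besselThetaK0 x ^ (b + 2))
        + (b + 1) * (x ^ 2 * (besselK0 x ^ (a + 2) * besselThetaK0 x ^ b))) / x) x :=
    fun x hx => by
      convert! ((hasDerivAt_besselK0 hx).pow (a + 1)).mul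
        ((hasDerivAt_besselThetaK0 hx).pow (b + 1)) using 1
      simp only [Nat.add_sub_cancel, Pi.pow_apply]
      push_cast
      field_simp
      ring
  rw [← integral_pow_mul_theta_mixed hab k hQ, mixedMoment, mixedMoment,
    ← integral_const_mul, ← integral_const_mul, ← integral_add i1 i2]
  · congr 1; ext x; exact hcongr x
  · exact IntegrableOn.congr_fun (i1.add i2) (fun x _ => hcongr x) measurableSet_Ioi

theorem mixedMoment_rec_four (k : ℕ) :
    4 * mixedMoment 1 3 (k + 3) = -((k + 2) * mixedMoment 0 4 (k + 1)) := by
  have i1 := (integrableOn_mixed (a := 1) (b := 3) rfl (k + 2)).const_mul 4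
  have hcongr : ∀ x : ℝ, 4 * (x ^ (k + 2 + 1) * (besselK0 x ^ 1 * besselThetaK0 x ^ 3))
      = x ^ (k + 1) * (4 * (x ^ 2 * (besselK0 x ^ 1 * besselThetaK0 x ^ 3))) := fun x => by ring
  have hQ : ∀ x, 0 < x → HasDerivAt (fun x => besselK0 x ^ 0 * besselThetaK0 x ^ 4)
      (4 * (x ^ 2 * (besselK0 x ^ 1 * besselThetaK0 x ^ 3)) / x) x := fun x hx => by
    convert! ((hasDerivAt_besselK0 hx).pow 0).mul ((hasDerivAt_besselThetaK0 hx).pow 4) using 1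
    simp
    field_simp
  rw [← integral_pow_mul_theta_mixed rfl k hQ, mixedMoment, ← integral_const_mul]
  · congr 1; ext x; exact hcongr x
  · exact IntegrableOn.congr_fun i1 (fun x _ => hcongr x) measurableSet_Ioi

theorem mixedMoment_four_zero (k : ℕ) : mixedMoment 4 0 k = besselMoment 4 k := by
  simp [mixedMoment, besselMoment]

theorem besselMoment_four_three :
    besselMoment 4 3 = besselMoment 4 1 / 4 - 3 / 16 := by
  have h := mixedMoment_one_three_one
  have a1 := mixedMoment_rec_zero 0
  have a3 := mixedMoment_rec_zero 2
  have b1 := mixedMoment_rec_succ (a := 2) (b := 0) rfl 0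
  have c1 := mixedMoment_rec_succ (a := 1) (b := 1) rfl 0
  simp only [Nat.reduceAdd, mixedMoment_four_zero] at a1 a3 b1 c1
  push_cast at a1 a3 b1 c1
  linarith

/-- The recursion for the moments of `K₀⁴`, obtained by eliminating the mixed moments. -/
theorem besselMoment_four_rec (k : ℕ) :
    ((k : ℝ) + 2) ^ 5 * besselMoment 4 (k + 1)
      - 4 * ((k : ℝ) + 3) * (5 * ((k : ℝ) + 3) ^ 2 + 3) * besselMoment 4 (k + 3)
      + 64 * ((k : ℝ) + 4) * besselMoment 4 (k + 5) = 0 := by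
  have a2 := mixedMoment_rec_zero k
  have a1 := mixedMoment_rec_zero (k + 2)
  have a0 := mixedMoment_rec_zero (k + 4)
  have b2 := mixedMoment_rec_succ (a := 2) (b := 0) rfl k
  have b1 := mixedMoment_rec_succ (a := 2) (b := 0) rfl (k + 2)
  have c2 := mixedMoment_rec_succ (a := 1) (b := 1) rfl k
  have c1 := mixedMoment_rec_succ (a := 1) (b := 1) rfl (k + 2)
  have d2 := mixedMoment_rec_succ (a := 0) (b := 2) rfl k
  have f2 := mixedMoment_rec_four k
  simp only [Nat.reduceAdd, add_assoc, mixedMoment_four_zero] at a0 a1 a2 b1 b2 c1 c2 d2 f2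
  push_cast at a0 a1 a2 b1 b2 c1 c2 d2 f2
  linear_combination ((k : ℝ) + 2) ^ 4 * a2 - 4 * ((k : ℝ) + 2) ^ 3 * b2
    + 12 * ((k : ℝ) + 2) ^ 2 * c2 - 24 * ((k : ℝ) + 2) * d2 + 24 * f2 - 48 * c1
    + (40 * (k : ℝ) + 112) * b1
    - (24 * ((k : ℝ) + 2) ^ 2 + (40 * (k : ℝ) + 112) * ((k : ℝ) + 4)) / 4 * a1 + 24 * a0

end MomentRecursion

section LaplaceTransform
open Set Filter Topology Real
open ENNReal (ofReal)

theorem lintegral_ofReal_of_hasDerivAt {F g : ℝ → ℝ} {a b : ℝ}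
    (hF : ∀ x, HasDerivAt F (g x) x) (hg : Continuous g) (hg0 : ∀ x, 0 ≤ g x)
    (ha : Tendsto F atBot (𝓝 a)) (hb : Tendsto F atTop (𝓝 b)) :
    ∫⁻ x, ofReal (g x) = ofReal (b - a) := by
  have hm : AEMeasurable (fun x => ofReal (g x)) volume := by fun_prop
  refine (aecover_Ioc (μ := volume) tendsto_neg_atTop_atBot
    tendsto_id).lintegral_eq_of_tendsto _ hm ?_
  refine Tendsto.congr' (f₁ := fun n : ℝ => ofReal (F n - F (-n))) ?_ ?_
  · filter_upwards [eventually_ge_atTop 0] with n hn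
    have hle : -n ≤ n := by linarith
    rw [id, ← intervalIntegral.integral_eq_sub_of_hasDerivAt (fun x _ => hF x)
      (hg.intervalIntegrable _ _), intervalIntegral.integral_of_le hle,
      ofReal_integral_eq_lintegral_ofReal]
    · exact (hg.intervalIntegrable (μ := volume) (-n) n).1
    · exact ae_of_all _ hg0
  · exact ENNReal.tendsto_ofReal (hb.sub (ha.comp tendsto_neg_atTop_atBot))

theorem lintegral_Ioi_ofReal_of_hasDerivAt {F g : ℝ → ℝ} {b : ℝ}
    (hF : ∀ x, HasDerivAt F (g x) x) (hg0 : ∀ x, 0 < x → 0 ≤ g x)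
    (hb : Tendsto F atTop (𝓝 b)) :
    ∫⁻ x in Ioi 0, ofReal (g x) = ofReal (b - F 0) := by
  rw [← integral_Ioi_of_hasDerivAt_of_nonneg' (fun x _ => hF x) (fun x hx => hg0 x hx) hb,
    ofReal_integral_eq_lintegral_ofReal]
  · exact integrableOn_Ioi_deriv_of_nonneg' (fun x _ => hF x) (fun x hx => hg0 x hx) hb
  · exact (ae_restrict_iff' measurableSet_Ioi).2 (ae_of_all _ hg0)

theorem lintegral_of_even {f : ℝ → ENNReal} (hf : ∀ x, f (-x) = f x) :
    ∫⁻ x, f x = 2 * ∫⁻ x in Ioi 0, f x := by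
  have h1 : ∫⁻ x in Iic 0, f x = ∫⁻ x in Ioi 0, f x := by
    rw [restrict_Iio_eq_restrict_Iic.symm]
    have := (Measure.measurePreserving_neg (volume : Measure ℝ)).setLIntegral_comp_preimage_emb
      (MeasurableEquiv.neg ℝ).measurableEmbedding f (Iio 0)
    rw [← this]
    simp [hf]
  rw [← lintegral_add_compl f (measurableSet_Iic (a := (0 : ℝ))), compl_Iic, h1, two_mul]

theorem lintegral_comp_two_mul (f : ℝ → ENNReal) :
    ∫⁻ x, f x = 2 * ∫⁻ x, f (2 * x) := by
  have h := Real.smul_map_volume_mul_left (a := 2) two_ne_zero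
  conv_lhs => rw [← h]
  rw [lintegral_smul_measure]
  have := (Homeomorph.mulLeft₀ (2 : ℝ) two_ne_zero).measurableEmbedding.lintegral_map
    (μ := volume) f
  simp only [Homeomorph.coe_mulLeft₀] at this
  rw [this]
  simp

theorem sq_lintegral_exp_neg_mul_cosh {x : ℝ} (hx : 0 < x) :
    (∫⁻ s, ofReal (exp (-x * cosh s))) ^ 2 =
      2 * ∫⁻ p, ∫⁻ u, ofReal (exp (-exp u - x ^ 2 * cosh p ^ 2 * exp (-u))) := by
  have h1 : (∫⁻ s, ofReal (exp (-x * cosh s))) ^ 2 =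
      ∫⁻ s, ∫⁻ t, ofReal (exp (-x * (cosh s + cosh t))) := by
    rw [sq, ← lintegral_mul_const _ (by fun_prop)]
    refine lintegral_congr fun s => ?_
    rw [← lintegral_const_mul _ (by fun_prop)]
    refine lintegral_congr fun t => ?_
    rw [← ENNReal.ofReal_mul (exp_nonneg _), ← exp_add]
    ring_nf
  have h2 (s : ℝ) : ∫⁻ t, ofReal (exp (-x * (cosh s + cosh t))) =
      2 * ∫⁻ q, ofReal (exp (-x * (cosh s + cosh (s - 2 * q)))) := by
    rw [← lintegral_sub_left_eq_self _ s, lintegral_comp_two_mul]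
  have h3 (q : ℝ) : ∫⁻ s, ofReal (exp (-x * (cosh s + cosh (s - 2 * q)))) =
      ∫⁻ p, ofReal (exp (-2 * x * cosh p * cosh q)) := by
    rw [← lintegral_add_right_eq_self _ q]
    refine lintegral_congr fun p => ?_
    rw [show p + q - 2 * q = p - q by ring, cosh_add, cosh_sub]
    ring_nf
  have h4 (p : ℝ) : ∫⁻ q, ofReal (exp (-2 * x * cosh p * cosh q)) =
      ∫⁻ u, ofReal (exp (-exp u - x ^ 2 * cosh p ^ 2 * exp (-u))) := by
    rw [← lintegral_sub_right_eq_self _ (log (x * cosh p))]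
    refine lintegral_congr fun u => ?_
    have hc : 0 < x * cosh p := mul_pos hx (cosh_pos p)
    have := cosh_pos p
    rw [cosh_eq (u - _), neg_sub, exp_sub, exp_sub, exp_log hc, exp_neg u]
    congr 2
    field_simp
    ring
  rw [h1]
  simp_rw [h2]
  rw [lintegral_const_mul _ (by fun_prop), lintegral_lintegral_swap (by fun_prop)]
  simp_rw [h3]
  rw [lintegral_lintegral_swap (by fun_prop)]
  simp_rw [h4]

theorem lintegral_Ioi_mul_exp_neg_mul_sq {c : ℝ} (hc : 0 < c) :
    ∫⁻ x in Ioi (0 : ℝ), ofReal (x * exp (-(c * x ^ 2))) = ofReal (1 / (2 * c)) := by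
  rw [lintegral_Ioi_ofReal_of_hasDerivAt (F := fun x => -(exp (-(c * x ^ 2)) / (2 * c))) (b := 0)]
  · simp
  · intro x
    have h := (((((hasDerivAt_id x).pow 2).const_mul c).neg.exp).div_const (2 * c)).neg
    refine h.congr_deriv ?_
    simp only [id]
    field_simp
    simp
    ring
  · intro x hx; positivity
  · have h : Tendsto (fun x : ℝ => c * x ^ 2) atTop atTop :=
      (tendsto_pow_atTop two_ne_zero).const_mul_atTop hc
    simpa using ((tendsto_exp_neg_atTop_nhds_zero.comp h).div_const (2 * c)).neg

theorem lintegral_exp_mul_exp_neg_mul_exp {m : ℝ} (hm : 0 < m) :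
    ∫⁻ u, ofReal (exp u * exp (-(m * exp u))) = ofReal (1 / m) := by
  rw [lintegral_ofReal_of_hasDerivAt (F := fun u => -(exp (-(m * exp u)) / m)) (a := -(1 / m))
    (b := 0)]
  · simp
  · intro x
    have h := ((((Real.hasDerivAt_exp x).const_mul m).neg.exp).div_const m).neg
    refine h.congr_deriv ?_
    field_simp
    rfl
  · fun_prop
  · intro x; positivity
  · have h : Tendsto (fun x : ℝ => -(m * exp x)) atBot (𝓝 (-(m * 0))) :=
      (tendsto_exp_atBot.const_mul m).neg
    simpa using (((continuous_exp.tendsto _).comp h).div_const m).neg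
  · have h : Tendsto (fun x : ℝ => m * exp x) atTop atTop := tendsto_exp_atTop.const_mul_atTop hm
    simpa using ((tendsto_exp_neg_atTop_nhds_zero.comp h).div_const m).neg

end LaplaceTransform

section FourfoldIntegral
open Set Filter Topology Real
open ENNReal (ofReal)

theorem lintegral_Ioi_mul_exp_mul_exp {a b : ℝ} (ha : 0 < a) (hb : 0 < b) :
    ∫⁻ x in Ioi (0 : ℝ), ofReal x *
      ((∫⁻ u, ofReal (exp (-exp u - x ^ 2 * a ^ 2 * exp (-u)))) *
        ∫⁻ v, ofReal (exp (-exp v - x ^ 2 * b ^ 2 * exp (-v)))) =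
      ∫⁻ w, ofReal (exp w / (2 * ((a ^ 2 + exp w) * (b ^ 2 + exp w)))) := by
  have h1 : ∀ x ∈ Ioi (0 : ℝ), ofReal x *
      ((∫⁻ u, ofReal (exp (-exp u - x ^ 2 * a ^ 2 * exp (-u)))) *
        ∫⁻ v, ofReal (exp (-exp v - x ^ 2 * b ^ 2 * exp (-v)))) =
      ∫⁻ u, ∫⁻ v, ofReal (exp (-exp u - exp v)) *
        ofReal (x * exp (-((a ^ 2 * exp (-u) + b ^ 2 * exp (-v)) * x ^ 2))) := by
    intro x hx
    rw [← lintegral_mul_const _ (by fun_prop), ← lintegral_const_mul _ (by fun_prop)]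
    refine lintegral_congr fun u => ?_
    rw [← lintegral_const_mul _ (by fun_prop), ← lintegral_const_mul _ (by fun_prop)]
    refine lintegral_congr fun v => ?_
    have hx' : 0 ≤ x := le_of_lt hx
    rw [← ENNReal.ofReal_mul (exp_nonneg _), ← ENNReal.ofReal_mul hx',
      ← ENNReal.ofReal_mul (exp_nonneg _), ← exp_add, mul_left_comm, ← exp_add]
    ring_nf
  have hm : Measurable fun z : ℝ × ℝ => ∫⁻ v, ofReal (exp (-exp z.2 - exp v)) *
      ofReal (z.1 * exp (-((a ^ 2 * exp (-z.2) + b ^ 2 * exp (-v)) * z.1 ^ 2))) :=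
    Measurable.lintegral_prod_right' (f := fun q : (ℝ × ℝ) × ℝ =>
      ofReal (exp (-exp q.1.2 - exp q.2)) * ofReal (q.1.1 *
        exp (-((a ^ 2 * exp (-q.1.2) + b ^ 2 * exp (-q.2)) * q.1.1 ^ 2)))) (by fun_prop)
  have h2 (u : ℝ) : ∫⁻ x in Ioi (0 : ℝ), ∫⁻ v, ofReal (exp (-exp u - exp v)) *
        ofReal (x * exp (-((a ^ 2 * exp (-u) + b ^ 2 * exp (-v)) * x ^ 2))) =
      ∫⁻ w, ofReal (1 / (2 * (a ^ 2 + b ^ 2 * exp (-w)))) *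
        ofReal (exp u * exp (-((1 + exp w) * exp u))) := by
    rw [lintegral_lintegral_swap (by fun_prop), ← lintegral_add_right_eq_self _ u]
    refine lintegral_congr fun w => ?_
    rw [lintegral_const_mul _ (by fun_prop), lintegral_Ioi_mul_exp_neg_mul_sq (by positivity),
      ← ENNReal.ofReal_mul (exp_nonneg _), ← ENNReal.ofReal_mul (by positivity),
      neg_add, exp_add, exp_add, show -((1 + exp w) * exp u) = -exp u - exp w * exp u by ring,
      exp_neg u]
    congr 1
    have := exp_pos u
    have := exp_pos (-w)
    field_simp
  have h3 (w : ℝ) : ∫⁻ u, ofReal (1 / (2 * (a ^ 2 + b ^ 2 * exp (-w)))) *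
        ofReal (exp u * exp (-((1 + exp w) * exp u))) =
      ofReal (1 / (2 * (a ^ 2 + b ^ 2 * exp (-w)) * (1 + exp w))) := by
    rw [lintegral_const_mul _ (by fun_prop), lintegral_exp_mul_exp_neg_mul_exp (by positivity),
      ← ENNReal.ofReal_mul (by positivity)]
    congr 1
    field_simp
  rw [setLIntegral_congr_fun measurableSet_Ioi h1, lintegral_lintegral_swap hm.aemeasurable]
  simp_rw [h2]
  rw [lintegral_lintegral_swap (by fun_prop)]
  simp_rw [h3]
  rw [← lintegral_sub_right_eq_self _ (log (a ^ 2))]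
  refine lintegral_congr fun w => ?_
  rw [neg_sub, exp_sub, exp_sub, exp_log (by positivity)]
  congr 1
  have := exp_pos w
  field_simp
  ring

theorem lintegral_Ioi_mul_lintegral_sq :
    ∫⁻ x in Ioi (0 : ℝ), ofReal x *
      (∫⁻ p, ∫⁻ u, ofReal (exp (-exp u - x ^ 2 * cosh p ^ 2 * exp (-u)))) ^ 2 =
      ∫⁻ w, ofReal (exp w / 2) * (∫⁻ p, ofReal (1 / (cosh p ^ 2 + exp w))) ^ 2 := by
  have hm : Measurable fun z : ℝ × ℝ =>
      ∫⁻ u, ofReal (exp (-exp u - z.1 ^ 2 * cosh z.2 ^ 2 * exp (-u))) :=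
    Measurable.lintegral_prod_right' (f := fun q : (ℝ × ℝ) × ℝ =>
      ofReal (exp (-exp q.2 - q.1.1 ^ 2 * cosh q.1.2 ^ 2 * exp (-q.2)))) (by fun_prop)
  set h : ℝ → ℝ → ENNReal := fun x p =>
    ∫⁻ u, ofReal (exp (-exp u - x ^ 2 * cosh p ^ 2 * exp (-u))) with hh
  have hm' : Measurable (Function.uncurry h) := hm
  have hmx (x : ℝ) : Measurable (h x) := hm'.of_uncurry_left
  have hmp (p : ℝ) : Measurable (fun x => h x p) := hm'.of_uncurry_right
  have h1 (x : ℝ) : ofReal x * (∫⁻ p, h x p) ^ 2 =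
      ∫⁻ p, ∫⁻ r, ofReal x * (h x p * h x r) := by
    rw [sq, ← lintegral_mul_const _ (hmx x), ← lintegral_const_mul _ ((hmx x).mul_const _)]
    refine lintegral_congr fun p => ?_
    rw [← lintegral_const_mul _ (hmx x), ← lintegral_const_mul _ ((hmx x).const_mul _)]
  have hm1 : Measurable fun z : (ℝ × ℝ) × ℝ => h z.1.1 z.1.2 :=
    hm'.comp measurable_fst
  have hm2 : Measurable fun z : (ℝ × ℝ) × ℝ => h z.1.1 z.2 :=
    hm'.comp (measurable_fst.fst.prodMk measurable_snd)
  have hm3 : Measurable fun z : (ℝ × ℝ) × ℝ => ofReal z.1.1 * (h z.1.1 z.1.2 * h z.1.1 z.2) :=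
    (by fun_prop : Measurable fun z : (ℝ × ℝ) × ℝ => ofReal z.1.1).mul (hm1.mul hm2)
  have h2 (p r : ℝ) : ∫⁻ x in Ioi (0 : ℝ), ofReal x * (h x p * h x r) =
      ∫⁻ w, ofReal (exp w / (2 * ((cosh p ^ 2 + exp w) * (cosh r ^ 2 + exp w)))) :=
    lintegral_Ioi_mul_exp_mul_exp (cosh_pos p) (cosh_pos r)
  have h3 (p : ℝ) : ∫⁻ x in Ioi (0 : ℝ), ∫⁻ r, ofReal x * (h x p * h x r) =
      ∫⁻ r, ∫⁻ w, ofReal (exp w / (2 * ((cosh p ^ 2 + exp w) * (cosh r ^ 2 + exp w)))) := by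
    rw [lintegral_lintegral_swap]
    · simp_rw [h2]
    · refine Measurable.aemeasurable ?_
      exact hm3.comp ((measurable_fst.prodMk measurable_const).prodMk measurable_snd)
  have hm4 : Measurable fun z : ℝ × ℝ × ℝ => ofReal (exp z.2.2 /
      (2 * ((cosh z.1 ^ 2 + exp z.2.2) * (cosh z.2.1 ^ 2 + exp z.2.2)))) := by fun_prop
  have h4 (w p r : ℝ) : ofReal (exp w / (2 * ((cosh p ^ 2 + exp w) * (cosh r ^ 2 + exp w)))) =
      ofReal (exp w / 2) * (ofReal (1 / (cosh p ^ 2 + exp w)) *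
        ofReal (1 / (cosh r ^ 2 + exp w))) := by
    rw [← ENNReal.ofReal_mul (by positivity), ← ENNReal.ofReal_mul (by positivity)]
    congr 1
    field_simp
  change ∫⁻ x in Ioi (0 : ℝ), ofReal x * (∫⁻ p, h x p) ^ 2 = _
  simp_rw [h1]
  rw [lintegral_lintegral_swap (Measurable.lintegral_prod_right' hm3).aemeasurable]
  simp_rw [h3]
  have h5 (p : ℝ) :
      ∫⁻ r, ∫⁻ w, ofReal (exp w / (2 * ((cosh p ^ 2 + exp w) * (cosh r ^ 2 + exp w)))) =
      ∫⁻ w, ∫⁻ r, ofReal (exp w / (2 * ((cosh p ^ 2 + exp w) * (cosh r ^ 2 + exp w)))) :=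
    lintegral_lintegral_swap (by fun_prop)
  simp_rw [h5]
  rw [lintegral_lintegral_swap]
  · refine lintegral_congr fun w => ?_
    simp_rw [h4]
    rw [sq, ← lintegral_mul_const _ (by fun_prop), ← lintegral_const_mul _ (by fun_prop)]
    refine lintegral_congr fun p => ?_
    rw [← lintegral_const_mul _ (by fun_prop), ← lintegral_const_mul _ (by fun_prop)]
  · refine Measurable.aemeasurable (Measurable.lintegral_prod_right' (f := fun q : (ℝ × ℝ) × ℝ =>
      ofReal (exp q.1.2 / (2 * ((cosh q.1.1 ^ 2 + exp q.1.2) * (cosh q.2 ^ 2 + exp q.1.2)))))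
      (by fun_prop))

theorem tendsto_log_cosh_sub (θ : ℝ) :
    Tendsto (fun p => log (cosh (p + θ)) - log (cosh (p - θ))) atTop (𝓝 (2 * θ)) := by
  have h0 : Tendsto (fun p : ℝ => exp (-2 * p)) atTop (𝓝 0) :=
    tendsto_exp_atBot.comp (tendsto_id.const_mul_atTop_of_neg (by norm_num))
  have h1 : Tendsto (fun p => (exp θ + exp (-2 * p) * exp (-θ)) /
      (exp (-θ) + exp (-2 * p) * exp θ)) atTop
      (𝓝 ((exp θ + 0 * exp (-θ)) / (exp (-θ) + 0 * exp θ))) :=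
    (tendsto_const_nhds.add (h0.mul_const _)).div (tendsto_const_nhds.add (h0.mul_const _))
      (by simp)
  have h2 : (exp θ + 0 * exp (-θ)) / (exp (-θ) + 0 * exp θ) = exp (2 * θ) := by
    rw [zero_mul, zero_mul, add_zero, add_zero, ← exp_sub]
    ring_nf
  rw [h2] at h1
  have h3 := (continuousAt_log (exp_pos (2 * θ)).ne').tendsto.comp h1
  rw [log_exp] at h3
  refine h3.congr fun p => ?_
  rw [← log_div (cosh_pos _).ne' (cosh_pos _).ne', Function.comp_apply, cosh_eq, cosh_eq]
  congr 1
  rw [show -2 * p = -p + -p by ring, neg_add, neg_sub, sub_eq_add_neg, sub_eq_add_neg]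
  simp only [exp_add, exp_neg]
  have := exp_pos p
  have := exp_pos θ
  field_simp

theorem lintegral_one_div_cosh_sq_add {θ : ℝ} (hθ : 0 < θ) :
    ∫⁻ p, ofReal (1 / (cosh p ^ 2 + sinh θ ^ 2)) = ofReal (2 * θ / (sinh θ * cosh θ)) := by
  have hs : 0 < sinh θ := sinh_pos_iff.2 hθ
  have hc := cosh_pos θ
  have ht := (tendsto_log_cosh_sub θ).div_const (2 * (sinh θ * cosh θ))
  rw [lintegral_ofReal_of_hasDerivAt (F := fun p =>
    (log (cosh (p + θ)) - log (cosh (p - θ))) / (2 * (sinh θ * cosh θ)))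
    (a := -(2 * θ / (2 * (sinh θ * cosh θ)))) (b := 2 * θ / (2 * (sinh θ * cosh θ)))]
  · congr 1
    field_simp
    ring
  · intro p
    have h1 : HasDerivAt (fun p => log (cosh (p + θ))) (sinh (p + θ) / cosh (p + θ)) p := by
      simpa using (((hasDerivAt_id p).add_const θ).cosh).log (cosh_pos _).ne'
    have h2 : HasDerivAt (fun p => log (cosh (p - θ))) (sinh (p - θ) / cosh (p - θ)) p := by
      simpa using (((hasDerivAt_id p).sub_const θ).cosh).log (cosh_pos _).ne'
    refine ((h1.sub h2).div_const _).congr_deriv ?_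
    have h3 := cosh_pos (p + θ)
    have h4 := cosh_pos (p - θ)
    have h5 : cosh p ^ 2 + sinh θ ^ 2 = cosh (p + θ) * cosh (p - θ) := by
      rw [cosh_add, cosh_sub]
      linear_combination -cosh p ^ 2 * cosh_sq_sub_sinh_sq θ - sinh θ ^ 2 * cosh_sq_sub_sinh_sq p
    have h6 : sinh (p + θ) * cosh (p - θ) - sinh (p - θ) * cosh (p + θ) =
        2 * (sinh θ * cosh θ) := by
      rw [cosh_add, cosh_sub, sinh_add, sinh_sub]
      linear_combination 2 * sinh θ * cosh θ * cosh_sq_sub_sinh_sq p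
    rw [h5, div_sub_div _ _ h3.ne' h4.ne', mul_comm (cosh (p + θ)) (sinh (p - θ)), h6]
    field_simp
  · refine continuous_const.div (by fun_prop) fun p => ?_
    positivity
  · intro p; positivity
  · refine (ht.comp tendsto_neg_atBot_atTop).neg.congr fun p => ?_
    rw [Function.comp_apply, show -p + θ = -(p - θ) by ring, show -p - θ = -(p + θ) by ring,
      cosh_neg, cosh_neg]
    ring
  · exact ht

theorem lintegral_exp_mul_sq :
    ∫⁻ w, ofReal (exp w / 2) * (∫⁻ p, ofReal (1 / (cosh p ^ 2 + exp w))) ^ 2 =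
      ∫⁻ θ in Ioi (0 : ℝ), ofReal (4 * θ ^ 2 / (sinh θ * cosh θ)) := by
  have himg : (fun θ => 2 * log (sinh θ)) '' Ioi 0 = univ := by
    refine eq_univ_of_forall fun w => ⟨arsinh (exp (w / 2)), arsinh_pos_iff.2 (exp_pos _), ?_⟩
    simp only [sinh_arsinh, log_exp]
    ring
  have hinj : InjOn (fun θ => 2 * log (sinh θ)) (Ioi 0) := by
    intro x hx y hy h
    exact sinh_injective (log_injOn_pos (sinh_pos_iff.2 hx) (sinh_pos_iff.2 hy) (by simpa using h))
  have hd : ∀ θ ∈ Ioi (0 : ℝ), HasDerivWithinAt (fun θ => 2 * log (sinh θ))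
      (2 * (cosh θ / sinh θ)) (Ioi 0) θ := fun θ hθ =>
    (((hasDerivAt_sinh θ).log (sinh_pos_iff.2 hθ).ne').const_mul 2).hasDerivWithinAt
  rw [← setLIntegral_univ, ← himg,
    lintegral_image_eq_lintegral_abs_deriv_mul measurableSet_Ioi hd hinj]
  refine setLIntegral_congr_fun measurableSet_Ioi fun θ hθ => ?_
  have hs : 0 < sinh θ := sinh_pos_iff.2 hθ
  have hc := cosh_pos θ
  have hθ' : 0 < θ := hθ
  have he : exp (2 * log (sinh θ)) = sinh θ ^ 2 := by
    rw [two_mul, exp_add, exp_log hs, sq]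
  simp only [he]
  rw [lintegral_one_div_cosh_sq_add hθ, ← ENNReal.ofReal_pow (by positivity),
    ← ENNReal.ofReal_mul (by positivity), ← ENNReal.ofReal_mul (by positivity),
    abs_of_pos (by positivity)]
  congr 1
  field_simp
  norm_num

theorem lintegral_sq_div_sinh_mul_cosh :
    ∫⁻ θ in Ioi (0 : ℝ), ofReal (4 * θ ^ 2 / (sinh θ * cosh θ)) =
      ofReal (4 * ∑' k : ℕ, 1 / (2 * (k : ℝ) + 1) ^ 3) := by
  have h1 : ∀ θ ∈ Ioi (0 : ℝ), ofReal (4 * θ ^ 2 / (sinh θ * cosh θ)) =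
      ∑' k : ℕ, ofReal (16 * (θ ^ (2 : ℕ) * exp (-((4 * k + 2) * θ)))) := by
    intro θ hθ
    have hθ' : 0 < θ := hθ
    have hr : exp (-4 * θ) < 1 := by
      rw [exp_lt_one_iff]
      linarith
    have hg := (hasSum_geometric_of_lt_one (exp_nonneg (-4 * θ)) hr).mul_left
      (16 * (θ ^ 2 * exp (-2 * θ)))
    have hf : (fun k : ℕ => 16 * (θ ^ (2 : ℕ) * exp (-((4 * k + 2) * θ)))) =
        fun k => 16 * (θ ^ 2 * exp (-2 * θ)) * exp (-4 * θ) ^ k := by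
      funext k
      rw [← exp_nat_mul, mul_assoc, mul_assoc, ← exp_add]
      ring_nf
    rw [← hf] at hg
    rw [← ENNReal.ofReal_tsum_of_nonneg (fun k => by positivity) hg.summable, hg.tsum_eq]
    congr 1
    have hs : 0 < sinh θ := sinh_pos_iff.2 hθ
    have hc := cosh_pos θ
    have h4 : 0 < 1 - exp (-4 * θ) := by linarith
    have hsc : sinh θ * cosh θ * (4 * exp (-2 * θ)) = 1 - exp (-4 * θ) := by
      rw [sinh_eq, cosh_eq, show -2 * θ = -θ + -θ by ring,
        show -4 * θ = -θ + -θ + -θ + -θ by ring]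
      simp only [exp_add, exp_neg]
      field_simp
      ring
    rw [← hsc]
    field_simp
    norm_num
  have h2 (k : ℕ) : ∫⁻ θ in Ioi (0 : ℝ), ofReal (16 * (θ ^ (2 : ℕ) * exp (-((4 * k + 2) * θ)))) =
      ofReal (4 * (1 / (2 * (k : ℝ) + 1) ^ 3)) := by
    have hk : (0 : ℝ) < 4 * k + 2 := by positivity
    have hi := integral_rpow_mul_exp_neg_mul_Ioi (a := 3) (by norm_num) hk
    have hG : Gamma (3 : ℝ) = 2 := by
      have := Gamma_nat_eq_factorial 2
      norm_num at this ⊢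
    have hI : IntegrableOn (fun θ : ℝ => θ ^ (2 : ℕ) * exp (-((4 * k + 2) * θ))) (Ioi 0) := by
      have := integrableOn_rpow_mul_exp_neg_mul_rpow (s := 2) (p := 1) (by norm_num) one_pos hk
      refine this.congr_fun (fun θ _ => ?_) measurableSet_Ioi
      simp only [rpow_two, rpow_one, neg_mul]
    have hi' : ∫ θ in Ioi (0 : ℝ), θ ^ (2 : ℕ) * exp (-((4 * k + 2) * θ)) =
        2 / (4 * k + 2) ^ 3 := by
      norm_num [hG] at hi
      rw [hi]
      field_simp
    rw [← ofReal_integral_eq_lintegral_ofReal (hI.const_mul 16), integral_const_mul, hi']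
    · congr 1
      field_simp
      ring
    · refine (ae_restrict_iff' measurableSet_Ioi).2 (ae_of_all _ fun θ hθ => ?_)
      have hθ' : 0 < θ := hθ
      positivity
  have hsum : Summable fun k : ℕ => 1 / (2 * (k : ℝ) + 1) ^ 3 := by
    have := (Real.summable_one_div_nat_pow.2 (by norm_num : 1 < 3)).comp_injective
      (i := fun k : ℕ => 2 * k + 1) (fun a b h => by simpa using h)
    simpa [Function.comp_def] using this
  rw [setLIntegral_congr_fun measurableSet_Ioi h1, lintegral_tsum fun k => by fun_prop]
  simp_rw [h2]
  rw [← ENNReal.ofReal_tsum_of_nonneg (fun k => by positivity) (hsum.mul_left 4), tsum_mul_left]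

theorem tsum_one_div_odd_pow_three :
    ∑' k : ℕ, 1 / (2 * (k : ℝ) + 1) ^ 3 = 7 / 8 * zeta3 := by
  obtain ⟨f, hf⟩ : ∃ f : ℕ → ℝ, ∀ n, f n = 1 / ((n : ℝ) + 1) ^ 3 := ⟨_, fun _ => rfl⟩
  have hz : zeta3 = ∑' n, f n := tsum_congr fun n => (hf n).symm
  have hs : Summable f := by
    have := (summable_nat_add_iff 1).2 (Real.summable_one_div_nat_pow.2 (by norm_num : 1 < 3))
    refine this.congr fun n => ?_
    rw [hf]
    push_cast
    rfl
  have h := tsum_even_add_odd (f := f) (hs.comp_injective (i := fun k => 2 * k)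
    fun a b h => by simpa using h) (hs.comp_injective (i := fun k => 2 * k + 1)
    fun a b h => by simpa using h)
  have he : ∑' k : ℕ, f (2 * k) = ∑' k : ℕ, 1 / (2 * (k : ℝ) + 1) ^ 3 :=
    tsum_congr fun k => by rw [hf]; push_cast; rfl
  have ho : ∑' k : ℕ, f (2 * k + 1) = 1 / 8 * zeta3 := by
    rw [hz, ← tsum_mul_left]
    refine tsum_congr fun k => ?_
    rw [hf, hf]
    push_cast
    rw [show (2 * (k : ℝ) + 1 + 1) = 2 * (k + 1) by ring]
    field_simp
    norm_num
  rw [he, ho, ← hz] at h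
  linarith

end FourfoldIntegral

section FourthMoment
open Set Filter Topology Real
open ENNReal (ofReal)

theorem besselK0_nonneg (x : ℝ) : 0 ≤ besselK0 x := by
  rw [besselK0_eq_coshMoment]
  exact coshMoment_nonneg 0 x

theorem lintegral_exp_neg_mul_cosh {x : ℝ} (hx : 0 < x) :
    ∫⁻ s, ofReal (exp (-x * cosh s)) = ofReal (2 * besselK0 x) := by
  rw [lintegral_of_even fun s => by rw [cosh_neg], besselK0,
    ← ofReal_integral_eq_lintegral_ofReal, ENNReal.ofReal_mul two_pos.le, ENNReal.ofReal_ofNat]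
  · simpa [IntegrableOn] using integrableOn_cosh_pow_mul_exp 0 hx
  · exact ae_of_all _ fun s => exp_nonneg _

theorem ofReal_besselK0_pow_four {x : ℝ} (hx : 0 < x) :
    ofReal (4 * besselK0 x ^ 4) =
      (∫⁻ p, ∫⁻ u, ofReal (exp (-exp u - x ^ 2 * cosh p ^ 2 * exp (-u)))) ^ 2 := by
  have hK := besselK0_nonneg x
  have h := sq_lintegral_exp_neg_mul_cosh hx
  rw [lintegral_exp_neg_mul_cosh hx, ← ENNReal.ofReal_pow (by positivity),
    show (2 * besselK0 x) ^ 2 = 2 * (2 * besselK0 x ^ 2) by ring,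
    ENNReal.ofReal_mul two_pos.le, ENNReal.ofReal_ofNat,
    ENNReal.mul_right_inj two_ne_zero ENNReal.ofNat_ne_top] at h
  rw [← h, ← ENNReal.ofReal_pow (by positivity)]
  ring_nf

theorem besselMoment_four_one : besselMoment 4 1 = 7 / 8 * zeta3 := by
  have hz : 0 ≤ ∑' k : ℕ, 1 / (2 * (k : ℝ) + 1) ^ 3 := tsum_nonneg fun k => by positivity
  have h1 : ∫⁻ x in Ioi (0 : ℝ), ofReal (4 * (x ^ 1 * besselK0 x ^ 4)) =
      ofReal (4 * ∑' k : ℕ, 1 / (2 * (k : ℝ) + 1) ^ 3) := by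
    rw [← lintegral_sq_div_sinh_mul_cosh, ← lintegral_exp_mul_sq, ← lintegral_Ioi_mul_lintegral_sq]
    refine setLIntegral_congr_fun measurableSet_Ioi fun x hx => ?_
    have hx' : 0 < x := hx
    rw [← ofReal_besselK0_pow_four hx, ← ENNReal.ofReal_mul hx'.le]
    ring_nf
  have h2 : ∫ x in Ioi (0 : ℝ), 4 * (x ^ 1 * besselK0 x ^ 4) =
      4 * ∑' k : ℕ, 1 / (2 * (k : ℝ) + 1) ^ 3 := by
    rw [integral_eq_lintegral_of_nonneg_ae, h1, ENNReal.toReal_ofReal (by positivity)]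
    · refine (ae_restrict_iff' measurableSet_Ioi).2 (ae_of_all _ fun x hx => ?_)
      have hx' : 0 < x := hx
      have := besselK0_nonneg x
      positivity
    · refine ContinuousOn.aestronglyMeasurable ?_ measurableSet_Ioi
      exact continuousOn_const.mul ((continuousOn_id.pow 1).mul (continuousOn_besselK0.pow 4))
  rw [integral_const_mul] at h2
  rw [besselMoment, ← tsum_one_div_odd_pow_three]
  linarith

end FourthMoment

/-- With `d_n = (16^n/(n!)²) c_{4,2n+1}`,
`A_n = Σ_{k=0}^n C(n,k)² C(2k,k) C(2n−2k,n−k)`, and `B` the solution of the recursion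
`(n+2)³ B_{n+2} = 2(2n+3)(5n²+15n+12) B_{n+1} − 64(n+1)³ B_n` with `B_0 = 0`, `B_1 = 1`,
we have `d_n = (7/8) ζ(3) A_n − 3 B_n` for all `n`. -/
theorem bessel_moment_four_closed_form
    (d A B : ℕ → ℝ)
    (hd : ∀ n, d n = 16 ^ n / (n.factorial : ℝ) ^ 2 * besselMoment 4 (2 * n + 1))
    (hA : ∀ n, A n = ∑ k ∈ Finset.range (n + 1),
      ((n.choose k : ℝ)) ^ 2 * ((2 * k).choose k : ℝ) * ((2 * n - 2 * k).choose (n - k) : ℝ))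
    (hB0 : B 0 = 0) (hB1 : B 1 = 1)
    (hBrec : ∀ n : ℕ, ((n : ℝ) + 2) ^ 3 * B (n + 2)
      = 2 * (2 * (n : ℝ) + 3) * (5 * (n : ℝ) ^ 2 + 15 * n + 12) * B (n + 1)
        - 64 * ((n : ℝ) + 1) ^ 3 * B n) :
    ∀ n : ℕ, d n = 7 / 8 * zeta3 * A n - 3 * B n := by
  obtain ⟨c, hc⟩ : ∃ c : ℕ → ℝ, ∀ n, c n = PowerSeries.coeff n (besselISeries ^ 4) :=
    ⟨_, fun _ => rfl⟩
  have hf (n : ℕ) : ((n.factorial : ℕ) : ℝ) ≠ 0 := by exact_mod_cast n.factorial_ne_zero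
  have hf1 (n : ℕ) : (((n + 1).factorial : ℕ) : ℝ) = (n + 1) * n.factorial := by
    rw [Nat.factorial_succ]
    push_cast
    ring
  have hf2 (n : ℕ) : (((n + 2).factorial : ℕ) : ℝ) = (n + 2) * ((n + 1) * n.factorial) := by
    rw [← hf1, Nat.factorial_succ]
    push_cast
    ring
  have hAc (n : ℕ) : A n = (n.factorial : ℝ) ^ 2 * c n := by
    rw [hc, coeff_besselISeries_pow_four, hA, mul_div_cancel₀ _ (pow_ne_zero 2 (hf n))]
  have hArec (n : ℕ) : ((n : ℝ) + 2) ^ 3 * A (n + 2)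
      = 2 * (2 * (n : ℝ) + 3) * (5 * (n : ℝ) ^ 2 + 15 * n + 12) * A (n + 1)
        - 64 * ((n : ℝ) + 1) ^ 3 * A n := by
    have h := coeff_besselISeries_pow_four_rec n
    simp only [← hc] at h
    rw [hAc, hAc, hAc, hf2, hf1]
    linear_combination (n + 1 : ℝ) ^ 2 * (n.factorial : ℝ) ^ 2 * h
  have hdrec (n : ℕ) : ((n : ℝ) + 2) ^ 3 * d (n + 2)
      = 2 * (2 * (n : ℝ) + 3) * (5 * (n : ℝ) ^ 2 + 15 * n + 12) * d (n + 1)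
        - 64 * ((n : ℝ) + 1) ^ 3 * d n := by
    have h := besselMoment_four_rec (2 * n)
    rw [hd, hd, hd, hf2, hf1, show 2 * (n + 2) + 1 = 2 * n + 5 by ring,
      show 2 * (n + 1) + 1 = 2 * n + 3 by ring]
    push_cast at h
    have hn := hf n
    have h1 : (n : ℝ) + 1 ≠ 0 := by positivity
    have h2 : (n : ℝ) + 2 ≠ 0 := by positivity
    field_simp
    linear_combination 2 * 16 ^ n * h
  have hd0 : d 0 = 7 / 8 * zeta3 * A 0 - 3 * B 0 := by
    rw [hd, hA, hB0, ← besselMoment_four_one]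
    norm_num
  have hd1 : d 1 = 7 / 8 * zeta3 * A 1 - 3 * B 1 := by
    rw [hd, hA, hB1, ← besselMoment_four_one]
    norm_num [besselMoment_four_three, Finset.sum_range_succ]
    ring
  have key (n : ℕ) : d n = 7 / 8 * zeta3 * A n - 3 * B n ∧
      d (n + 1) = 7 / 8 * zeta3 * A (n + 1) - 3 * B (n + 1) := by
    induction n with
    | zero => exact ⟨hd0, hd1⟩
    | succ n ih =>
      refine ⟨ih.2, ?_⟩
      have h2 : ((n : ℝ) + 2) ^ 3 ≠ 0 := by positivity
      refine mul_left_cancel₀ h2 ?_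
      have h3 := hdrec n
      rw [ih.1, ih.2] at h3
      linear_combination h3 - 7 / 8 * zeta3 * hArec n + 3 * hBrec n
  exact fun n => (key n).1
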